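/- Let m > 1 and i ≥ 1 be integers such that 2m/gcd(i, 2m) is even, let α be a generator of the multiplicative group GF(2^{2m})^*, let e = gcd(2^i + 1, 2^m + 1), and let a ∈ GF(2^{2m})^*. Then the function x ↦ Tr_{2m/m}(a x^{2^i+1}) from GF(2^{2m}) to GF(2^m) is a bent vectorial function (i.e., for every nonzero c ∈ GF(2^m), the Boolean function x ↦ Tr(c·Tr_{2m/m}(a x^{2^i+1})) is bent) if and only if e ≠ 1 and a does not lie in the subgroup of GF(2^{2m})^* generated by α^e. -/

import Mathlib

noncomputable section

/-- The finite field `GF(2^n)` is finite. -/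
instance (n : ℕ) : Fintype (GaloisField 2 n) := Fintype.ofFinite _

/-- The absolute trace map from `GF(2^(2m))` to `GF(2)`. -/
def tr (m : ℕ) (x : GaloisField 2 (2*m)) : ZMod 2 :=
  Algebra.trace (ZMod 2) (GaloisField 2 (2*m)) x

/-- A Boolean function `f : GF(2^(2m)) → GF(2)` is bent if all its Walsh
transform values have absolute value `2^m`. -/
def IsBent (m : ℕ) (f : GaloisField 2 (2*m) → ZMod 2) : Prop :=
  ∀ w : GaloisField 2 (2*m),
    |∑ x : GaloisField 2 (2*m), (-1 : ℤ) ^ ((f x + tr m (w * x)).val)| = 2 ^ m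

/-- A tuple `(f 0, …, f (ℓ-1))` of Boolean functions on `GF(2^(2m))` is a
`(2m, ℓ)` bent vectorial function if every nonzero `GF(2)`-linear combination
of the `f j` is bent. -/
def IsBentVectorial (m ℓ : ℕ) (f : Fin ℓ → GaloisField 2 (2*m) → ZMod 2) : Prop :=
  ∀ a : Fin ℓ → ZMod 2, a ≠ 0 → IsBent m (fun x => ∑ j, a j * f j x)

/-- The binary linear code `C(f 0, …, f (ℓ-1))` of length `2^(2m)` (with
coordinates indexed by `GF(2^(2m))`, a codeword being a function
`GF(2^(2m)) → GF(2)`, i.e. the truth table of a Boolean function), spanned by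
the truth tables of the `f j`, the truth tables of the linear functions
`x ↦ tr (w * x)` for all `w`, and the all-one vector. -/
def code (m ℓ : ℕ) (f : Fin ℓ → GaloisField 2 (2*m) → ZMod 2) :
    Submodule (ZMod 2) (GaloisField 2 (2*m) → ZMod 2) :=
  Submodule.span (ZMod 2)
    (Set.range f ∪ Set.range (fun w => fun x => tr m (w * x)) ∪ {fun _ => (1 : ZMod 2)})

/-- The Hamming weight of a codeword: the number of nonzero coordinates. -/
def wt (m : ℕ) (c : GaloisField 2 (2*m) → ZMod 2) : ℕ :=
  {x | c x ≠ 0}.ncard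

/-- The support of a codeword: the set of coordinates where it is nonzero. -/
def supp (m : ℕ) (c : GaloisField 2 (2*m) → ZMod 2) : Set (GaloisField 2 (2*m)) :=
  {x | c x ≠ 0}


/-- the sign character -/
def chi (s : ZMod 2) : ℤ := (-1 : ℤ) ^ s.val

theorem chi_add (s t : ZMod 2) : chi (s + t) = chi s * chi t := by
  revert s t; decide

theorem tr_add (m : ℕ) (x y : GaloisField 2 (2*m)) : tr m (x + y) = tr m x + tr m y := by
  simp [tr]

theorem tr_zero (m : ℕ) : tr m 0 = 0 := by simp [tr]

theorem tr_sq (m : ℕ) (x : GaloisField 2 (2*m)) : tr m (x ^ 2) = tr m x := by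
  haveI : Algebra.IsAlgebraic (ZMod 2) (GaloisField 2 (2*m)) :=
    Algebra.IsAlgebraic.of_finite _ _
  have := Algebra.trace_eq_of_algEquiv
    (FiniteField.frobeniusAlgEquivOfAlgebraic (ZMod 2) (GaloisField 2 (2*m))) x
  simpa [tr, ZMod.card] using this

theorem tr_pow (m i : ℕ) (x : GaloisField 2 (2*m)) : tr m (x ^ (2^i)) = tr m x := by
  induction i with
  | zero => simp
  | succ k ih => rw [pow_succ, pow_mul, tr_sq, ih]

theorem tr_surj (m : ℕ) (s : ZMod 2) : ∃ x, tr m x = s :=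
  Algebra.trace_surjective (ZMod 2) (GaloisField 2 (2*m)) s

theorem pow_inj (m i : ℕ) : Function.Injective (fun x : GaloisField 2 (2*m) => x ^ (2^i)) := by
  have := iterateFrobenius_inj (GaloisField 2 (2*m)) 2 i
  intro x y h
  apply this
  simpa [iterateFrobenius_def] using h

theorem pow_surj (m i : ℕ) : Function.Surjective (fun x : GaloisField 2 (2*m) => x ^ (2^i)) :=
  Finite.surjective_of_injective (pow_inj m i)

/-- the quadratic form expansion -/
theorem quad_add (m i : ℕ) (b x z : GaloisField 2 (2*m)) :
    tr m (b * (x + z) ^ (2^i+1)) = tr m (b * x ^ (2^i+1)) + tr m (b * z ^ (2^i+1))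
      + tr m ((b ^ (2^i) * z ^ (2^i*2^i) + b * z) * x ^ (2^i)) := by
  have h1 : tr m (b * z ^ (2^i) * x) = tr m (b ^ (2^i) * z ^ (2^i*2^i) * x ^ (2^i)) := by
    rw [← tr_pow m i (b * z ^ (2^i) * x)]
    congr 1
    rw [mul_pow, mul_pow, ← pow_mul]
  rw [add_mul, tr_add m (b ^ (2^i) * z ^ (2^i*2^i) * x ^ (2^i)), ← h1, ← tr_add, ← tr_add, ← tr_add]
  congr 1
  rw [pow_succ, add_pow_char_pow]
  ring

theorem sum_zero (m : ℕ) (L : GaloisField 2 (2*m) → ZMod 2) (hL : ∀ x y, L (x+y) = L x + L y)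
    (x0 : GaloisField 2 (2*m)) (h0 : L x0 = 1) : ∑ x, chi (L x) = 0 := by
  have h : ∑ x, chi (L x) = ∑ x, chi (L (x + x0)) :=
    (Equiv.sum_comp (Equiv.addRight x0) (fun x => chi (L x))).symm
  have h2 : ∀ x, chi (L (x + x0)) = - chi (L x) := by
    intro x
    rw [hL, h0, chi_add]
    simp [chi, ZMod.val_one]
  simp only [h2, Finset.sum_neg_distrib] at h
  linarith

theorem card_gf (m : ℕ) (hm : 1 < m) : Fintype.card (GaloisField 2 (2*m)) = 2 ^ (2*m) := by
  rw [← Nat.card_eq_fintype_card, GaloisField.card 2 (2*m) (by omega)]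

theorem bent_of (m i : ℕ) (hm : 1 < m) (b : GaloisField 2 (2*m))
    (hb : ∀ z, z ≠ 0 → b ^ (2^i) * z ^ (2^i*2^i) + b * z ≠ 0) :
    IsBent m (fun x => tr m (b * x ^ (2^i+1))) := by
  intro w
  change |∑ x, chi (tr m (b * x ^ (2^i+1)) + tr m (w * x))| = 2 ^ m
  set W := ∑ x, chi (tr m (b * x ^ (2^i+1)) + tr m (w * x)) with hW
  have key : W * W = (2^m) * (2^m) := by
    have e1 : W * W = ∑ x, ∑ z, chi (tr m (b * x ^ (2^i+1)) + tr m (w * x)) *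
        chi (tr m (b * (x+z) ^ (2^i+1)) + tr m (w * (x+z))) := by
      conv_lhs => rw [hW, Finset.sum_mul_sum]
      refine Finset.sum_congr rfl fun x _ => ?_
      exact (Equiv.sum_comp (Equiv.addLeft x) (fun y =>
        chi (tr m (b * x ^ (2^i+1)) + tr m (w * x)) *
        chi (tr m (b * y ^ (2^i+1)) + tr m (w * y)))).symm
    have e2 : ∀ x z, chi (tr m (b * x ^ (2^i+1)) + tr m (w * x)) *
        chi (tr m (b * (x+z) ^ (2^i+1)) + tr m (w * (x+z))) =
        chi (tr m (b * z ^ (2^i+1)) + tr m (w * z)) *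
          chi (tr m ((b ^ (2^i) * z ^ (2^i*2^i) + b * z) * x ^ (2^i))) := by
      intro x z
      rw [quad_add, mul_add, tr_add m (w*x), ← chi_add, ← chi_add]
      congr 1
      generalize tr m (b * x ^ (2^i+1)) = p
      generalize tr m (w * x) = q
      linear_combination CharTwo.add_self_eq_zero p + CharTwo.add_self_eq_zero q
    simp only [e1, e2]
    rw [Finset.sum_comm]
    rw [Finset.sum_eq_single 0]
    · have h2 : (2^i*2^i) ≠ 0 := by positivity
      simp [tr_zero, chi, card_gf m hm, h2]
      ring
    · intro z _ hz
      rw [← Finset.mul_sum]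
      obtain ⟨t, ht⟩ := tr_surj m 1
      obtain ⟨x0, hx0⟩ := pow_surj m i (t / (b ^ (2^i) * z ^ (2^i*2^i) + b * z))
      have hu := hb z hz
      rw [sum_zero m (fun x => tr m ((b ^ (2^i) * z ^ (2^i*2^i) + b * z) * x ^ (2^i))) _ x0,
        mul_zero]
      · simp only at hx0
        simp only [hx0]
        rw [mul_div_cancel₀ _ hu, ht]
      · intro x y
        rw [add_pow_char_pow, mul_add, tr_add]
    · simp
  have := abs_eq_abs.mpr (mul_self_eq_mul_self_iff.mp key)
  rw [this, abs_of_nonneg (by positivity)]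

theorem not_bent_of (m i : ℕ) (b z : GaloisField 2 (2*m)) (hz : z ≠ 0)
    (hb : b ^ (2^i) * z ^ (2^i*2^i) + b * z = 0) :
    ¬ IsBent m (fun x => tr m (b * x ^ (2^i+1))) := by
  intro H
  obtain ⟨t, ht⟩ := tr_surj m (tr m (b * z ^ (2^i+1)) + 1)
  have Hw := H (t / z)
  change |∑ x, chi (tr m (b * x ^ (2^i+1)) + tr m (t / z * x))| = 2 ^ m at Hw
  have h : ∑ x, chi (tr m (b * x ^ (2^i+1)) + tr m (t / z * x)) =
      ∑ x, chi (tr m (b * (x+z) ^ (2^i+1)) + tr m (t / z * (x+z))) :=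
    (Equiv.sum_comp (Equiv.addRight z)
      (fun x => chi (tr m (b * x ^ (2^i+1)) + tr m (t / z * x)))).symm
  have h2 : ∀ x, chi (tr m (b * (x+z) ^ (2^i+1)) + tr m (t / z * (x+z))) =
      - chi (tr m (b * x ^ (2^i+1)) + tr m (t / z * x)) := by
    intro x
    have : - chi (tr m (b * x ^ (2^i+1)) + tr m (t / z * x)) =
      chi (tr m (b * x ^ (2^i+1)) + tr m (t / z * x) + 1) := by
      rw [chi_add _ 1]; simp [chi, ZMod.val_one]
    rw [this, quad_add, hb, zero_mul, tr_zero, mul_add, tr_add, div_mul_cancel₀ _ hz, ht]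
    congr 1
    generalize tr m (b * z ^ (2^i+1)) = p
    linear_combination CharTwo.add_self_eq_zero p
  simp only [h2, Finset.sum_neg_distrib] at h
  have h3 : ∑ x, chi (tr m (b * x ^ (2^i+1)) + tr m (t / z * x)) = 0 := by linarith
  rw [h3] at Hw
  have : (0:ℤ) < 2 ^ m := by positivity
  simp at Hw
  omega

theorem kernel_iff (m i : ℕ) (b : GaloisField 2 (2*m)) :
    (∃ z, z ≠ 0 ∧ b ^ (2^i) * z ^ (2^i*2^i) + b * z = 0) ↔
      b = 0 ∨ ∃ x, x ≠ 0 ∧ b = x ^ (2^i+1) := by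
  constructor
  · rintro ⟨z, hz, h⟩
    by_cases hb0 : b = 0
    · exact Or.inl hb0
    right
    have h' := CharTwo.add_eq_zero.mp h
    obtain ⟨s, hs⟩ := pow_surj m 1 (b * z ^ (2^i+1))
    simp only [pow_one] at hs
    have ht : (b * z ^ (2^i+1)) ^ (2^i) = b * z ^ (2^i+1) := by
      calc (b * z ^ (2^i+1)) ^ (2^i) = (b ^ (2^i) * z ^ (2^i*2^i)) * z ^ (2^i) := by
            rw [mul_pow, ← pow_mul]; ring
        _ = _ := by rw [h']; ring
    have hs' : s ^ (2^i) = s := by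
      apply pow_inj m 1
      simp only [pow_one]
      rw [pow_right_comm, hs, ht]
    have hs0 : s ≠ 0 := by
      rintro rfl
      have : b * z ^ (2^i+1) ≠ 0 := mul_ne_zero hb0 (pow_ne_zero _ hz)
      exact this (by rw [← hs]; simp)
    refine ⟨s / z, div_ne_zero hs0 hz, ?_⟩
    rw [div_pow, pow_succ s, hs', ← pow_two, hs, mul_div_cancel_right₀ _ (pow_ne_zero _ hz)]
  · rintro (rfl | ⟨x, hx, rfl⟩)
    · exact ⟨1, one_ne_zero, by simp⟩
    · refine ⟨x⁻¹, inv_ne_zero hx, ?_⟩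
      rw [CharTwo.add_eq_zero]
      have h1 : (x ^ (2^i+1)) * x⁻¹ = x ^ (2^i) := by
        rw [pow_succ, mul_assoc, mul_inv_cancel₀ hx, mul_one]
      rw [h1, pow_mul, ← mul_pow]
      congr 1
      rw [inv_pow, pow_succ]; field_simp

theorem bent_iff (m i : ℕ) (hm : 1 < m) (b : GaloisField 2 (2*m)) (hb : b ≠ 0) :
    IsBent m (fun x => tr m (b * x ^ (2^i+1))) ↔ ¬ ∃ x, x ≠ 0 ∧ b = x ^ (2^i+1) := by
  have k := kernel_iff m i b
  simp only [hb, false_or] at k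
  rw [← k]
  constructor
  · rintro H ⟨z, hz, h⟩
    exact not_bent_of m i b z hz h H
  · intro H
    apply bent_of m i hm b
    intro z hz h
    exact H ⟨z, hz, h⟩

theorem grp (m d : ℕ) (hm : 1 < m) (α : (GaloisField 2 (2*m))ˣ)
    (hα : ∀ z : (GaloisField 2 (2*m))ˣ, z ∈ Subgroup.zpowers α)
    (a : (GaloisField 2 (2*m))ˣ) :
    a ∈ Subgroup.zpowers (α ^ Nat.gcd d (2^m + 1)) ↔
      ∃ c x : (GaloisField 2 (2*m))ˣ, c ^ (2^m) = c ∧ c * a = x ^ d := by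
  have hcard : ∀ z : (GaloisField 2 (2*m))ˣ, z ^ (2^(2*m)) = z := by
    intro z
    ext
    rw [Units.val_pow_eq_pow_val, ← card_gf m hm, FiniteField.pow_card]
  have hord : orderOf α = 2^(2*m) - 1 := by
    rw [orderOf_eq_card_of_forall_mem_zpowers hα, Nat.card_units, ← card_gf m hm,
      Nat.card_eq_fintype_card]
  constructor
  · rintro ⟨k, hk⟩
    have hk : (α ^ Nat.gcd d (2^m + 1)) ^ k = a := hk
    have bez := Nat.gcd_eq_gcd_ab d (2^m+1)
    set u := Nat.gcdA d (2^m+1)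
    set v := Nat.gcdB d (2^m+1)
    refine ⟨((α ^ (v*k)) ^ (2^m+1))⁻¹, α ^ (u*k), ?_, ?_⟩
    · generalize α ^ (v*k) = β
      rw [inv_pow, ← pow_mul]
      congr 1
      have : (2^m+1)*2^m = 2^(2*m) + 2^m := by ring
      rw [this, pow_add, hcard, pow_succ, mul_comm β]
    · rw [inv_mul_eq_iff_eq_mul, ← hk, ← zpow_natCast α, ← zpow_mul, bez, ← zpow_natCast,
        ← zpow_natCast, ← zpow_mul, ← zpow_mul, ← zpow_add]
      congr 1
      push_cast
      ring
  · rintro ⟨c, x, hc, hx⟩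
    obtain ⟨k, hk⟩ := hα c
    obtain ⟨j, hj⟩ := hα x
    have hk : α ^ k = c := hk
    have hj : α ^ j = x := hj
    have h1 : α ^ (k * (2^m - 1)) = 1 := by
      rw [mul_sub, zpow_sub, mul_one, zpow_mul, hk]
      have : c ^ ((2:ℤ)^m) = c := by
        have h := zpow_natCast c (2^m)
        push_cast at h
        rw [h, hc]
      rw [this, mul_inv_cancel]
    have h2 := orderOf_dvd_iff_zpow_eq_one.mpr h1
    have h3 : ((orderOf α : ℕ) : ℤ) = (2^m+1) * (2^m-1) := by
      rw [hord, Nat.cast_sub Nat.one_le_two_pow]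
      push_cast
      ring
    have hpos : (2^m - 1 : ℤ) ≠ 0 := by
      have : (2:ℤ)^1 < 2^m := pow_lt_pow_right₀ (by norm_num) hm
      omega
    rw [h3] at h2
    have h4 := (mul_dvd_mul_iff_right hpos).mp h2
    have hak : a = α ^ (j * d - k) := by
      rw [zpow_sub, zpow_mul, hj, zpow_natCast, ← hx, hk, mul_comm c, mul_assoc, mul_inv_cancel,
        mul_one]
    have h5 : ((Nat.gcd d (2^m+1) : ℕ) : ℤ) ∣ j * d - k := by
      apply dvd_sub
      · exact Dvd.dvd.mul_left (Int.natCast_dvd_natCast.mpr (Nat.gcd_dvd_left _ _)) _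
      · refine dvd_trans ?_ h4
        have := Int.natCast_dvd_natCast.mpr (Nat.gcd_dvd_right d (2^m+1))
        exact_mod_cast this
    obtain ⟨q, hq⟩ := h5
    refine ⟨q, ?_⟩
    change (α ^ Nat.gcd d (2^m + 1)) ^ q = a
    rw [hak, hq, zpow_mul, zpow_natCast]

/-- for `m > 1`, `i ≥ 1` with `2m / gcd(i, 2m)` even, a
generator `α` of `GF(2^(2m))^*`, `e = gcd(2^i + 1, 2^m + 1)` and
`a ∈ GF(2^(2m))^*`, the function `x ↦ Tr_{2m/m}(a x^(2^i+1))` is a bent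
vectorial function (i.e. `x ↦ tr (c * a * x^(2^i+1))` is bent for every
nonzero `c` in the subfield `GF(2^m)`) iff `e ≠ 1` and `a ∉ ⟨α^e⟩`. -/
theorem stmt_17 (m i : ℕ) (hm : 1 < m) (hi : 1 ≤ i)
    (he : Even ((2*m) / Nat.gcd i (2*m)))
    (α : (GaloisField 2 (2*m))ˣ)
    (hα : ∀ z : (GaloisField 2 (2*m))ˣ, z ∈ Subgroup.zpowers α)
    (a : (GaloisField 2 (2*m))ˣ) :
    (∀ c : GaloisField 2 (2*m), c ≠ 0 → c ^ (2^m) = c →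
        IsBent m (fun x => tr m (c * (a : GaloisField 2 (2*m)) * x ^ (2^i + 1)))) ↔
      (Nat.gcd (2^i + 1) (2^m + 1) ≠ 1 ∧
        a ∉ Subgroup.zpowers (α ^ Nat.gcd (2^i + 1) (2^m + 1))) := by
  have key : (∀ c : GaloisField 2 (2*m), c ≠ 0 → c ^ (2^m) = c →
        IsBent m (fun x => tr m (c * (a : GaloisField 2 (2*m)) * x ^ (2^i + 1)))) ↔
        a ∉ Subgroup.zpowers (α ^ Nat.gcd (2^i + 1) (2^m + 1)) := by
    rw [grp m (2^i+1) hm α hα a]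
    constructor
    · rintro H ⟨c, x, hc, hx⟩
      have hc' : (c : GaloisField 2 (2*m)) ^ (2^m) = c := by
        rw [← Units.val_pow_eq_pow_val, hc]
      refine (bent_iff m i hm _ (mul_ne_zero c.ne_zero a.ne_zero)).mp (H c c.ne_zero hc')
        ⟨x, x.ne_zero, ?_⟩
      rw [← Units.val_mul, hx, Units.val_pow_eq_pow_val]
    · intro H c hc0 hc
      rw [bent_iff m i hm _ (mul_ne_zero hc0 a.ne_zero)]
      rintro ⟨x, hx0, hx⟩
      refine H ⟨Units.mk0 c hc0, Units.mk0 x hx0, ?_, ?_⟩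
      · ext; simpa using hc
      · ext; simpa using hx
  rw [key]
  constructor
  · intro h
    refine ⟨?_, h⟩
    intro h1
    rw [h1, pow_one] at h
    exact h (hα a)
  · exact fun h => h.2
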